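/- Fix a nonempty partition π with k ≥ 1 blocks, and let b_{l,r} = b_{l,r}(q,p) ∈ ℤ[q,p] be the generating polynomials defined from π as in the context. Then for every l ≥ 1 and every r ≥ 0, b_{l,r} = b_{l−1,r−1} + (1 + [r+1]_{q,p})·b_{l−1,r} + [r+1]_{q,p}·b_{l−1,r+1}, where [m]_{q,p} = Σ_{t=0}^{m−1} q^t p^{m−1−t} and b_{l−1,−1} = 0. -/

import Mathlib

open Finset

/-- A set partition of `[n] = {1,…,n}`, modeled as a `Finpartition` of `Fin n`. -/
abbrev SetPartition (n : ℕ) := Finpartition (Finset.univ : Finset (Fin n))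

/-- `(i,j)` is an arc of the partition `p`: `i < j`, they lie in a common block,
and no element of that block lies strictly between them. -/
def IsArc {n : ℕ} (p : SetPartition n) (i j : Fin n) : Prop :=
  i < j ∧ ∃ B ∈ p.parts, i ∈ B ∧ j ∈ B ∧ ∀ x ∈ B, ¬ (i < x ∧ x < j)

/-- Arcs `a = (i₁,j₁)` and `b = (i₂,j₂)` form a crossing: `i₁ < i₂ < j₁ < j₂`. -/
def Crossing {n : ℕ} (a b : Fin n × Fin n) : Prop :=
  a.1 < b.1 ∧ b.1 < a.2 ∧ a.2 < b.2

/-- Arcs `a = (i₁,j₁)` and `b = (i₂,j₂)` form a nesting: `i₁ < i₂ < j₂ < j₁`. -/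
def Nesting {n : ℕ} (a b : Fin n × Fin n) : Prop :=
  a.1 < b.1 ∧ b.1 < b.2 ∧ b.2 < a.2

/-- `cr p`: the number of crossings of two arcs in `p`. -/
noncomputable def cr {n : ℕ} (p : SetPartition n) : ℕ :=
  {e : (Fin n × Fin n) × (Fin n × Fin n) |
    IsArc p e.1.1 e.1.2 ∧ IsArc p e.2.1 e.2.2 ∧ Crossing e.1 e.2}.ncard

/-- `ne' p`: the number of nestings of two arcs in `p`. -/
noncomputable def ne' {n : ℕ} (p : SetPartition n) : ℕ :=
  {e : (Fin n × Fin n) × (Fin n × Fin n) |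
    IsArc p e.1.1 e.1.2 ∧ IsArc p e.2.1 e.2.2 ∧ Nesting e.1 e.2}.ncard

/-- `al p`: the number of alignments (unordered pairs of arcs that neither
cross nor nest, counted with first endpoints in increasing order). -/
noncomputable def al {n : ℕ} (p : SetPartition n) : ℕ :=
  {e : (Fin n × Fin n) × (Fin n × Fin n) |
    IsArc p e.1.1 e.1.2 ∧ IsArc p e.2.1 e.2.2 ∧ e.1.1 < e.2.1 ∧
    ¬ Crossing e.1 e.2 ∧ ¬ Crossing e.2 e.1 ∧
    ¬ Nesting e.1 e.2 ∧ ¬ Nesting e.2 e.1}.ncard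

/-- `i` and `j` lie in a common block of `p`. -/
def InSameBlock {n : ℕ} (p : SetPartition n) (i j : Fin n) : Prop :=
  ∃ B ∈ p.parts, i ∈ B ∧ j ∈ B

/-- `c` (a partition of `[n+1]`) is a child of `p` (a partition of `[n]`):
deleting the element `1` from `c` and shifting down by one yields `p`. -/
def IsChild {n : ℕ} (c : SetPartition (n + 1)) (p : SetPartition n) : Prop :=
  ∀ i j : Fin n, (InSameBlock p i j ↔ InSameBlock c i.succ j.succ)

/-- `level p l` is `T(p, l)`: the set of partitions of `[n+l]` at the `l`-th level of
the subtree rooted at `p` in the tree of partitions. -/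
def level {n : ℕ} (p : SetPartition n) : (l : ℕ) → Set (SetPartition (n + l))
  | 0 => {p}
  | l + 1 => {c | ∃ q ∈ level p l, IsChild c q}

/-- The statistic `s_{α,β}(p) = cr(p)·α + ne(p)·β`. -/
noncomputable def statS {G : Type*} [AddCommGroup G] (α β : G) {n : ℕ} (p : SetPartition n) : G :=
  cr p • α + ne' p • β

/-- The minimum of a block, as a natural number (`0` for the empty set). -/
noncomputable def minOfBlock {n : ℕ} (B : Finset (Fin n)) : ℕ :=
  sInf (Fin.val '' (B : Set (Fin n)))

/-- The minima of the blocks of `p`, listed in increasing order; its `i`-th entry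
(0-indexed) is `b_{i+1}`, the minimum of the block `B_{i+1}`. -/
noncomputable def minsSorted {n : ℕ} (p : SetPartition n) : List ℕ :=
  (p.parts.image fun B => minOfBlock B).sort (· ≤ ·)

open Classical in
/-- The block of `p` containing the element with value `m` (junk if there is none). -/
noncomputable def blockOfNat {n : ℕ} (p : SetPartition n) (m : ℕ) : Finset (Fin n) :=
  (p.parts.filter fun B => ∃ x : Fin n, x ∈ B ∧ (x : ℕ) = m).sup id

/-- The children `λ⁰, λ¹, …, λᵏ` of a partition `λ` of `[n]`: `childAt p 0 = λ⁰` adds a new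
singleton block `{1}`, and for `1 ≤ i ≤ k`, `childAt p i = λⁱ` adds the new element `1`
to the block `B_i` (blocks ordered by increasing minima). It is defined via the setoid
whose classes are the blocks of the child partition. -/
noncomputable def childAt {n : ℕ} (p : SetPartition n) (i : ℕ) : SetPartition (n + 1) := by
  classical
  exact Finpartition.ofSetoid
    (Setoid.ker fun x : Fin (n + 1) =>
      if (x : ℕ) = 0 then
        (if i = 0 then none
         else some (blockOfNat p ((minsSorted p).getD (i - 1) 0)))
      else some (blockOfNat p ((x : ℕ) - 1)))

/-- `f_γ^r(x₁…x_l)`: the multiset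
`{x_{a₁} + ⋯ + x_{a_r} − (r−1)x₁ + γ : 1 < a₁ < ⋯ < a_r ≤ l}`, with one element for each
choice of `r` positions strictly after the first. -/
def fStat {G : Type*} [AddCommGroup G] (γ : G) (r : ℕ) (w : List G) : Multiset G :=
  ((w.tail.sublistsLen r).map fun c => c.sum - ((r : ℤ) - 1) • w.headD 0 + γ : List G)

/-- `seq_{α,β}(μ)` for `G = ℤ ⊕ ℤ`, `α = (1,0)`, `β = (0,1)`: the sequence
`(s_{α,β}(μ¹), …, s_{α,β}(μ^j)) = ((cr μ¹, ne μ¹), …, (cr μ^j, ne μ^j))`, where `j` is the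
number of blocks of `μ`. -/
noncomputable def seqCN {m : ℕ} (p : SetPartition m) : List (ℤ × ℤ) :=
  (List.range p.parts.card).map fun i =>
    ((cr (childAt p (i + 1)) : ℤ), (ne' (childAt p (i + 1)) : ℤ))

/-- `b_{l,r}(q,p) = Σ_{(x,y) ∈ f_0^r(E_l)} q^x p^y ∈ ℤ[q,p]`, where
`E_l = {seq_{α,β}(μ) : μ ∈ T(π,l)}` (a multiset, and the sum is with multiplicity).
Here `q = X 0` and `p = X 1` in `MvPolynomial (Fin 2) ℤ`, and the (in fact nonnegative)
integer coordinates are converted to natural-number exponents via `Int.toNat`. -/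
noncomputable def bPoly {n : ℕ} (p : SetPartition n) (l r : ℕ) :
    MvPolynomial (Fin 2) ℤ :=
  ∑ᶠ μ ∈ level p l,
    ((fStat ((0 : ℤ), (0 : ℤ)) r (seqCN μ)).map fun v =>
      MvPolynomial.X 0 ^ v.1.toNat * MvPolynomial.X 1 ^ v.2.toNat).sum

/-- `[m]_{q,p} = Σ_{t=0}^{m-1} q^t p^{m-1-t}`. -/
noncomputable def bracket (m : ℕ) : MvPolynomial (Fin 2) ℤ :=
  ∑ t ∈ Finset.range m, MvPolynomial.X 0 ^ t * MvPolynomial.X 1 ^ (m - 1 - t)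

lemma inSameBlock_iff {n : ℕ} (p : SetPartition n) (i j : Fin n) :
    InSameBlock p i j ↔ p.part i = p.part j := by
  constructor
  · rintro ⟨B, hB, hi, hj⟩
    rw [p.part_eq_of_mem hB hi, p.part_eq_of_mem hB hj]
  · intro h
    exact ⟨p.part i, p.part_mem.2 (mem_univ i), p.mem_part (mem_univ i),
      h ▸ p.mem_part (mem_univ j)⟩

lemma InSameBlock.symm {n : ℕ} {p : SetPartition n} {i j : Fin n} (h : InSameBlock p i j) :
    InSameBlock p j i := by
  rw [inSameBlock_iff] at *; exact h.symm

lemma InSameBlock.trans {n : ℕ} {p : SetPartition n} {i j k : Fin n}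
    (h : InSameBlock p i j) (h' : InSameBlock p j k) : InSameBlock p i k := by
  rw [inSameBlock_iff] at *; exact h.trans h'

lemma inSameBlock_refl {n : ℕ} (p : SetPartition n) (i : Fin n) : InSameBlock p i i :=
  (inSameBlock_iff p i i).2 rfl

lemma eq_of_inSameBlock_iff {n : ℕ} {p p' : SetPartition n}
    (h : ∀ i j, InSameBlock p i j ↔ InSameBlock p' i j) : p = p' := by
  have key : ∀ {p p' : SetPartition n}, (∀ i j, InSameBlock p i j ↔ InSameBlock p' i j) →
      p.parts ⊆ p'.parts := by
    intro p p' h B hB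
    obtain ⟨i, hi⟩ := p.nonempty_of_mem_parts hB
    have : B = p'.part i := by
      ext j
      rw [p'.mem_part_iff_part_eq_part (mem_univ j) (mem_univ i), eq_comm,
        ← inSameBlock_iff, ← h, inSameBlock_iff, p.part_eq_of_mem hB hi]
      constructor
      · intro hj; rw [p.part_eq_of_mem hB hj]
      · intro hj; rw [hj]; exact p.mem_part (mem_univ j)
    rw [this]
    exact p'.part_mem.2 (mem_univ i)
  exact Finpartition.ext ((key h).antisymm (key fun i j => (h i j).symm))

lemma isArc_iff {n : ℕ} (p : SetPartition n) (i j : Fin n) :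
    IsArc p i j ↔ i < j ∧ InSameBlock p i j ∧ ∀ x, InSameBlock p i x → ¬(i < x ∧ x < j) := by
  constructor
  · rintro ⟨hij, B, hB, hi, hj, h⟩
    refine ⟨hij, ⟨B, hB, hi, hj⟩, fun x hx => h x ?_⟩
    rw [inSameBlock_iff, p.part_eq_of_mem hB hi] at hx
    rw [hx]; exact p.mem_part (mem_univ x)
  · rintro ⟨hij, ⟨B, hB, hi, hj⟩, h⟩
    exact ⟨hij, B, hB, hi, hj, fun x hx => h x ⟨B, hB, hi, hx⟩⟩

lemma blockOfNat_val {n : ℕ} (p : SetPartition n) (x : Fin n) :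
    blockOfNat p x = p.part x := by
  classical
  have : (p.parts.filter fun B => ∃ y : Fin n, y ∈ B ∧ (y : ℕ) = x) = {p.part x} := by
    ext B
    simp only [mem_filter, mem_singleton]
    constructor
    · rintro ⟨hB, y, hy, hyx⟩
      obtain rfl := Fin.ext hyx
      exact (p.part_eq_of_mem hB hy).symm
    · rintro rfl
      exact ⟨p.part_mem.2 (mem_univ x), x, p.mem_part (mem_univ x), rfl⟩
  simp [blockOfNat, this]

/-- `x` is the least element of its block. -/
def IsBlockMin {n : ℕ} (p : SetPartition n) (x : Fin n) : Prop :=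
  ∀ y, InSameBlock p x y → x ≤ y

/-- The set of minima of the blocks of `p`. -/
noncomputable def blockMins {n : ℕ} (p : SetPartition n) : Finset ℕ :=
  p.parts.image fun B => minOfBlock B

lemma minOfBlock_part {n : ℕ} (p : SetPartition n) {x : Fin n} (hx : IsBlockMin p x) :
    minOfBlock (p.part x) = x := by
  refine (IsLeast.csInf_eq ⟨⟨x, p.mem_part (mem_univ x), rfl⟩, ?_⟩)
  rintro _ ⟨y, hy, rfl⟩
  exact hx y ⟨_, p.part_mem.2 (mem_univ x), p.mem_part (mem_univ x), hy⟩

lemma exists_isBlockMin {n : ℕ} (p : SetPartition n) (x : Fin n) :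
    ∃ b, InSameBlock p x b ∧ IsBlockMin p b := by
  classical
  obtain ⟨b, hb, hmin⟩ := (univ.filter fun y => InSameBlock p x y).exists_min_image id
    ⟨x, by simp [inSameBlock_refl]⟩
  simp only [mem_filter, mem_univ, true_and, id] at hb hmin
  exact ⟨b, hb, fun y hy => hmin y (hb.trans hy)⟩

lemma exists_part_of_mem {n : ℕ} (p : SetPartition n) {B : Finset (Fin n)} (hB : B ∈ p.parts) :
    ∃ b, B = p.part b ∧ IsBlockMin p b := by
  obtain ⟨x, hx⟩ := p.nonempty_of_mem_parts hB
  obtain ⟨b, hb, hmin⟩ := exists_isBlockMin p x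
  exact ⟨b, by rw [← (inSameBlock_iff p x b).1 hb, p.part_eq_of_mem hB hx], hmin⟩

lemma mem_blockMins {n : ℕ} (p : SetPartition n) (m : ℕ) :
    m ∈ blockMins p ↔ ∃ b : Fin n, IsBlockMin p b ∧ (b : ℕ) = m := by
  simp only [blockMins, mem_image]
  constructor
  · rintro ⟨B, hB, rfl⟩
    obtain ⟨b, rfl, hb⟩ := exists_part_of_mem p hB
    exact ⟨b, hb, (minOfBlock_part p hb).symm⟩
  · rintro ⟨b, hb, rfl⟩
    exact ⟨_, p.part_mem.2 (mem_univ b), minOfBlock_part p hb⟩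

lemma val_mem_blockMins {n : ℕ} (p : SetPartition n) (b : Fin n) :
    (b : ℕ) ∈ blockMins p ↔ IsBlockMin p b := by
  rw [mem_blockMins]
  exact ⟨fun ⟨b', h, e⟩ => Fin.ext e ▸ h, fun h => ⟨b, h, rfl⟩⟩

lemma card_blockMins {n : ℕ} (p : SetPartition n) : (blockMins p).card = p.parts.card := by
  refine card_image_of_injOn fun B hB B' hB' h => ?_
  obtain ⟨b, rfl, hb⟩ := exists_part_of_mem p hB
  obtain ⟨b', rfl, hb'⟩ := exists_part_of_mem p hB'
  simp only [minOfBlock_part p hb, minOfBlock_part p hb'] at h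
  rw [Fin.ext h]

/-- The child of `p` in which the new element is a singleton (`o = none`), or is added to the
block of the element with value `b` (`o = some b`). -/
noncomputable def extendBy {n : ℕ} (p : SetPartition n) (o : Option ℕ) : SetPartition (n + 1) := by
  classical
  exact Finpartition.ofSetoid
    (Setoid.ker fun x : Fin (n + 1) =>
      if (x : ℕ) = 0 then o.map (blockOfNat p) else some (blockOfNat p ((x : ℕ) - 1)))

lemma childAt_succ {n : ℕ} (p : SetPartition n) (i : ℕ) :
    childAt p (i + 1) = extendBy p (some ((minsSorted p).getD i 0)) := rfl

lemma inSameBlock_extendBy {n : ℕ} (p : SetPartition n) (o : Option ℕ) (x y : Fin (n + 1)) :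
    InSameBlock (extendBy p o) x y ↔
      (if (x : ℕ) = 0 then o.map (blockOfNat p) else some (blockOfNat p ((x : ℕ) - 1))) =
      (if (y : ℕ) = 0 then o.map (blockOfNat p) else some (blockOfNat p ((y : ℕ) - 1))) := by
  classical
  rw [inSameBlock_iff, extendBy,
    ← Finpartition.mem_part_iff_part_eq_part _ (mem_univ x) (mem_univ y),
    Finpartition.mem_part_ofSetoid_iff_rel]
  exact eq_comm

lemma inSameBlock_extendBy_succ {n : ℕ} (p : SetPartition n) (o : Option ℕ) (x y : Fin n) :
    InSameBlock (extendBy p o) x.succ y.succ ↔ InSameBlock p x y := by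
  rw [inSameBlock_extendBy, inSameBlock_iff]
  simp [blockOfNat_val]

lemma inSameBlock_extendBy_none {n : ℕ} (p : SetPartition n) (y : Fin n) :
    ¬ InSameBlock (extendBy p none) 0 y.succ := by
  simp [inSameBlock_extendBy]

lemma inSameBlock_extendBy_some {n : ℕ} (p : SetPartition n) (b y : Fin n) :
    InSameBlock (extendBy p (some b)) 0 y.succ ↔ InSameBlock p b y := by
  rw [inSameBlock_extendBy, inSameBlock_iff]
  simp [blockOfNat_val]

lemma isChild_extendBy {n : ℕ} (p : SetPartition n) (o : Option ℕ) :
    IsChild (extendBy p o) p := fun i j => (inSameBlock_extendBy_succ p o i j).symm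

lemma eq_of_inSameBlock_succ {n : ℕ} {p p' : SetPartition (n + 1)}
    (hs : ∀ i j : Fin n, InSameBlock p i.succ j.succ ↔ InSameBlock p' i.succ j.succ)
    (h0 : ∀ j : Fin n, InSameBlock p 0 j.succ ↔ InSameBlock p' 0 j.succ) : p = p' := by
  refine eq_of_inSameBlock_iff fun i j => ?_
  cases i using Fin.cases <;> cases j using Fin.cases
  · simp [inSameBlock_refl]
  · exact h0 _
  · exact ⟨fun h => ((h0 _).1 h.symm).symm, fun h => ((h0 _).2 h.symm).symm⟩
  · exact hs _ _

lemma exists_eq_extendBy {n : ℕ} {p : SetPartition n} {c : SetPartition (n + 1)}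
    (h : IsChild c p) : ∃ o ∈ insertNone (blockMins p), extendBy p o = c := by
  by_cases hx : ∃ x : Fin n, InSameBlock c 0 x.succ
  · obtain ⟨x, hx⟩ := hx
    obtain ⟨b, hb, hmin⟩ := exists_isBlockMin p x
    refine ⟨some b, by simp [val_mem_blockMins, hmin], eq_of_inSameBlock_succ
      (fun i j => (inSameBlock_extendBy_succ p _ i j).trans (h i j)) fun j => ?_⟩
    rw [inSameBlock_extendBy_some]
    have hcb : InSameBlock c 0 b.succ := hx.trans ((h _ _).1 hb)
    rw [h]
    exact ⟨hcb.trans, hcb.symm.trans⟩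
  · push Not at hx
    exact ⟨none, by simp, eq_of_inSameBlock_succ
      (fun i j => (inSameBlock_extendBy_succ p _ i j).trans (h i j)) fun j =>
      iff_of_false (inSameBlock_extendBy_none p j) (hx j)⟩

lemma injOn_extendBy {n : ℕ} (p : SetPartition n) :
    Set.InjOn (extendBy p) (insertNone (blockMins p) : Finset (Option ℕ)) := by
  have hne : ∀ b ∈ blockMins p, extendBy p none ≠ extendBy p (some b) := by
    intro b hb h
    obtain ⟨b, hb, rfl⟩ := (mem_blockMins p b).1 hb
    exact inSameBlock_extendBy_none p b
      (h ▸ (inSameBlock_extendBy_some p b b).2 (inSameBlock_refl p b))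
  rintro (_ | b) hb (_ | b') hb' h
  · rfl
  · exact absurd h (hne b' (by simpa using hb'))
  · exact absurd h.symm (hne b (by simpa using hb))
  · simp only [mem_coe, some_mem_insertNone] at hb hb'
    obtain ⟨b, hmin, rfl⟩ := (mem_blockMins p b).1 hb
    obtain ⟨b', hmin', rfl⟩ := (mem_blockMins p b').1 hb'
    have : InSameBlock p b b' := by
      rw [← inSameBlock_extendBy_some, h, inSameBlock_extendBy_some]
      exact inSameBlock_refl p b'
    rw [le_antisymm (hmin _ this) (hmin' _ this.symm)]

lemma finsum_mem_isChild {n : ℕ} {M : Type*} [AddCommMonoid M] (p : SetPartition n)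
    (F : SetPartition (n + 1) → M) :
    ∑ᶠ c ∈ {c | IsChild c p}, F c =
      F (extendBy p none) + ∑ b ∈ blockMins p, F (extendBy p (some b)) := by
  have : {c | IsChild c p} = extendBy p '' (insertNone (blockMins p) : Finset (Option ℕ)) := by
    ext c
    constructor
    · exact fun h => exists_eq_extendBy h
    · rintro ⟨o, -, rfl⟩
      exact isChild_extendBy p o
  rw [this, finsum_mem_image (injOn_extendBy p), finsum_mem_coe_finset, sum_insertNone]

lemma finsum_mem_level_succ {n : ℕ} {M : Type*} [AddCommMonoid M] (p : SetPartition n) (l : ℕ)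
    (F : SetPartition (n + l + 1) → M) :
    ∑ᶠ c ∈ level p (l + 1), F c =
      ∑ᶠ q ∈ level p l,
        (F (extendBy q none) + ∑ b ∈ blockMins q, F (extendBy q (some b))) := by
  have : level p (l + 1) = ⋃ q ∈ level p l, {c | IsChild c q} := by
    ext c; simp [level]
  rw [this, finsum_mem_biUnion _ (Set.toFinite _) fun _ _ => Set.toFinite _]
  · simp only [finsum_mem_isChild]
  · intro q _ q' _ hne
    refine Set.disjoint_left.2 fun c hc hc' => hne ?_
    exact eq_of_inSameBlock_iff fun i j => (hc i j).trans (hc' i j).symm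

/-- The set of arcs of `p`. -/
noncomputable def arcs {n : ℕ} (p : SetPartition n) : Finset (Fin n × Fin n) := by
  classical
  exact univ.filter fun a => IsArc p a.1 a.2

lemma mem_arcs {n : ℕ} {p : SetPartition n} {a : Fin n × Fin n} :
    a ∈ arcs p ↔ IsArc p a.1 a.2 := by
  simp [arcs]

/-- The number of arcs of `p` that pass over `x`. -/
noncomputable def coverCount {n : ℕ} (p : SetPartition n) (x : ℕ) : ℕ :=
  ∑ a ∈ arcs p, if (a.1 : ℕ) < x ∧ x < a.2 then 1 else 0

/-- The number of arcs of `p` that end before `x`. -/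
noncomputable def beforeCount {n : ℕ} (p : SetPartition n) (x : ℕ) : ℕ :=
  ∑ a ∈ arcs p, if (a.2 : ℕ) < x then 1 else 0

lemma isArc_extendBy_succ {n : ℕ} (p : SetPartition n) (o : Option ℕ) (i j : Fin n) :
    IsArc (extendBy p o) i.succ j.succ ↔ IsArc p i j := by
  simp [isArc_iff, inSameBlock_extendBy_succ, Fin.forall_fin_succ]

lemma isArc_extendBy_none {n : ℕ} (p : SetPartition n) (j : Fin n) :
    ¬ IsArc (extendBy p none) 0 j.succ := by
  simp [isArc_iff, inSameBlock_extendBy_none]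

lemma isArc_extendBy_some {n : ℕ} {p : SetPartition n} {b : Fin n} (hb : IsBlockMin p b)
    (j : Fin n) : IsArc (extendBy p (some b)) 0 j.succ ↔ j = b := by
  simp only [isArc_iff, inSameBlock_extendBy_some, Fin.forall_fin_succ, Fin.succ_pos, true_and,
    Fin.succ_lt_succ_iff, lt_irrefl, false_and, not_false_iff, implies_true]
  constructor
  · rintro ⟨hj, h⟩
    exact le_antisymm (not_lt.1 (h b (inSameBlock_refl p b))) (hb j hj)
  · rintro rfl
    exact ⟨inSameBlock_refl p j, fun x hx => not_lt.2 (hb x hx)⟩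

lemma sum_arcs_eq {n : ℕ} {M : Type*} [AddCommMonoid M] (p : SetPartition (n + 1))
    (F : Fin (n + 1) × Fin (n + 1) → M) [DecidableRel (IsArc p)] :
    ∑ a ∈ arcs p, F a = (∑ j : Fin n, if IsArc p 0 j.succ then F (0, j.succ) else 0) +
      ∑ a : Fin n × Fin n, if IsArc p a.1.succ a.2.succ then F (a.1.succ, a.2.succ) else 0 := by
  have h0 : ∀ i, ¬ IsArc p i 0 := fun i h => absurd h.1 (Fin.not_lt_zero _)
  have : arcs p = univ.filter fun a => IsArc p a.1 a.2 := by ext; simp [mem_arcs]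
  rw [this, sum_filter, Fintype.sum_prod_type, Fin.sum_univ_succ, Fintype.sum_prod_type]
  simp [Fin.sum_univ_succ, h0]

lemma sum_arcs_extendBy_none {n : ℕ} {M : Type*} [AddCommMonoid M] (p : SetPartition n)
    (F : Fin (n + 1) × Fin (n + 1) → M) :
    ∑ a ∈ arcs (extendBy p none), F a = ∑ a ∈ arcs p, F (a.1.succ, a.2.succ) := by
  classical
  rw [sum_arcs_eq]
  simp [isArc_extendBy_none, isArc_extendBy_succ, arcs, sum_filter]

lemma sum_arcs_extendBy_some {n : ℕ} {M : Type*} [AddCommMonoid M] {p : SetPartition n}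
    {b : Fin n} (hb : IsBlockMin p b) (F : Fin (n + 1) × Fin (n + 1) → M) :
    ∑ a ∈ arcs (extendBy p (some b)), F a =
      F (0, b.succ) + ∑ a ∈ arcs p, F (a.1.succ, a.2.succ) := by
  classical
  rw [sum_arcs_eq]
  simp [isArc_extendBy_some hb, isArc_extendBy_succ, arcs, sum_filter]

lemma ncard_arc_pairs {n : ℕ} (p : SetPartition n) (R : Fin n × Fin n → Fin n × Fin n → Prop)
    [DecidableRel R] :
    {e : (Fin n × Fin n) × (Fin n × Fin n) |
      IsArc p e.1.1 e.1.2 ∧ IsArc p e.2.1 e.2.2 ∧ R e.1 e.2}.ncard =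
    ∑ a ∈ arcs p, ∑ b ∈ arcs p, if R a b then 1 else 0 := by
  rw [← sum_product', ← card_filter, ← Set.ncard_coe_finset]
  congr 1
  ext e
  simp [mem_arcs, and_assoc]

instance {n : ℕ} : DecidableRel (Crossing (n := n)) := fun _ _ =>
  inferInstanceAs (Decidable (_ ∧ _))

instance {n : ℕ} : DecidableRel (Nesting (n := n)) := fun _ _ =>
  inferInstanceAs (Decidable (_ ∧ _))

lemma cr_eq_sum {n : ℕ} (p : SetPartition n) :
    cr p = ∑ a ∈ arcs p, ∑ b ∈ arcs p, if Crossing a b then 1 else 0 :=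
  ncard_arc_pairs p Crossing

lemma ne'_eq_sum {n : ℕ} (p : SetPartition n) :
    ne' p = ∑ a ∈ arcs p, ∑ b ∈ arcs p, if Nesting a b then 1 else 0 :=
  ncard_arc_pairs p Nesting

lemma crossing_succ {n : ℕ} (a b : Fin n × Fin n) :
    Crossing (a.1.succ, a.2.succ) (b.1.succ, b.2.succ) ↔ Crossing a b := by
  simp [Crossing]

lemma nesting_succ {n : ℕ} (a b : Fin n × Fin n) :
    Nesting (a.1.succ, a.2.succ) (b.1.succ, b.2.succ) ↔ Nesting a b := by
  simp [Nesting]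

lemma cr_extendBy_none {n : ℕ} (p : SetPartition n) : cr (extendBy p none) = cr p := by
  simp only [cr_eq_sum, sum_arcs_extendBy_none, crossing_succ]

lemma ne'_extendBy_none {n : ℕ} (p : SetPartition n) : ne' (extendBy p none) = ne' p := by
  simp only [ne'_eq_sum, sum_arcs_extendBy_none, nesting_succ]

lemma cr_extendBy_some {n : ℕ} {p : SetPartition n} {b : Fin n} (hb : IsBlockMin p b) :
    cr (extendBy p (some b)) = cr p + coverCount p b := by
  simp only [cr_eq_sum, sum_arcs_extendBy_some hb, crossing_succ]
  simp only [Crossing, coverCount, Fin.lt_def, Fin.val_zero, Fin.val_succ, lt_irrefl, false_and,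
    if_false, zero_add, Nat.not_lt_zero, Nat.succ_pos, true_and, add_lt_add_iff_right]
  rw [add_comm]

lemma ne'_extendBy_some {n : ℕ} {p : SetPartition n} {b : Fin n} (hb : IsBlockMin p b) :
    ne' (extendBy p (some b)) = ne' p + beforeCount p b := by
  simp only [ne'_eq_sum, sum_arcs_extendBy_some hb, nesting_succ]
  simp only [Nesting, beforeCount, Fin.lt_def, Fin.val_zero, Fin.val_succ, lt_irrefl, false_and,
    if_false, zero_add, Nat.not_lt_zero, Nat.succ_pos, true_and, add_lt_add_iff_right]
  rw [add_comm]
  congr 1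
  refine sum_congr rfl fun a ha => ?_
  have : (a.1 : ℕ) < a.2 := (mem_arcs.1 ha).1
  simp [this]

lemma coverCount_extendBy_none {n : ℕ} (p : SetPartition n) (x : ℕ) :
    coverCount (extendBy p none) (x + 1) = coverCount p x := by
  simp only [coverCount, sum_arcs_extendBy_none, Fin.val_succ, add_lt_add_iff_right]

lemma beforeCount_extendBy_none {n : ℕ} (p : SetPartition n) (x : ℕ) :
    beforeCount (extendBy p none) (x + 1) = beforeCount p x := by
  simp only [beforeCount, sum_arcs_extendBy_none, Fin.val_succ, add_lt_add_iff_right]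

lemma coverCount_extendBy_some {n : ℕ} {p : SetPartition n} {b : Fin n} (hb : IsBlockMin p b)
    (x : ℕ) : coverCount (extendBy p (some b)) (x + 1) =
      coverCount p x + if x < b then 1 else 0 := by
  simp [coverCount, sum_arcs_extendBy_some hb, add_comm]

lemma beforeCount_extendBy_some {n : ℕ} {p : SetPartition n} {b : Fin n} (hb : IsBlockMin p b)
    (x : ℕ) : beforeCount (extendBy p (some b)) (x + 1) =
      beforeCount p x + if b < x then 1 else 0 := by
  simp [beforeCount, sum_arcs_extendBy_some hb, add_comm]

lemma blockMins_extendBy_none {n : ℕ} (p : SetPartition n) :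
    (blockMins (extendBy p none)).erase 0 = (blockMins p).map (addRightEmbedding 1) := by
  ext m
  cases m with
  | zero => simp
  | succ m =>
    have h : ∀ y, ¬ InSameBlock (extendBy p none) (Fin.succ y) 0 :=
      fun y h => inSameBlock_extendBy_none p y h.symm
    simp [mem_blockMins, Fin.exists_fin_succ, IsBlockMin, Fin.forall_fin_succ,
      inSameBlock_extendBy_succ, h]

lemma isBlockMin_extendBy_some_succ {n : ℕ} {p : SetPartition n} {b : Fin n}
    (hb : IsBlockMin p b) (x : Fin n) :
    IsBlockMin (extendBy p (some b)) x.succ ↔ x ≠ b ∧ IsBlockMin p x := by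
  simp only [IsBlockMin, Fin.forall_fin_succ (P := fun y => InSameBlock _ _ y → _),
    inSameBlock_extendBy_succ, Fin.succ_le_succ_iff, Fin.le_zero_iff, Fin.succ_ne_zero, imp_false]
  refine and_congr_left fun hx => not_congr ⟨fun h => ?_, ?_⟩
  · have h' := (inSameBlock_extendBy_some p b x).1 h.symm
    exact le_antisymm (hx b h'.symm) (hb x h')
  · rintro rfl
    exact ((inSameBlock_extendBy_some p x x).2 (inSameBlock_refl p x)).symm

lemma blockMins_extendBy_some {n : ℕ} {p : SetPartition n} {b : Fin n} (hb : IsBlockMin p b) :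
    (blockMins (extendBy p (some b))).erase 0 =
      ((blockMins p).erase (b : ℕ)).map (addRightEmbedding 1) := by
  ext m
  cases m with
  | zero => simp
  | succ m =>
    simp only [mem_erase, ne_eq, Nat.add_eq_zero_iff, one_ne_zero, and_false, not_false_iff,
      mem_blockMins, Fin.exists_fin_succ, Fin.val_zero, isBlockMin_extendBy_some_succ hb, mem_map,
      true_and, Fin.val_succ, add_left_inj, addRightEmbedding_apply, Fin.ext_iff]
    grind

section ElementarySymmetric

variable {R : Type*} [CommSemiring R]

/-- The `r`-th elementary symmetric sum of the values of `w` on `s`. -/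
def elemSym (s : Finset ℕ) (w : ℕ → R) (r : ℕ) : R := ∑ t ∈ s.powersetCard r, ∏ x ∈ t, w x

lemma elemSym_zero (s : Finset ℕ) (w : ℕ → R) : elemSym s w 0 = 1 := by
  simp [elemSym]

lemma elemSym_insert {a : ℕ} {s : Finset ℕ} (ha : a ∉ s) (w : ℕ → R) (r : ℕ) :
    elemSym (insert a s) w (r + 1) = elemSym s w (r + 1) + w a * elemSym s w r := by
  have hmem : ∀ {m t}, t ∈ s.powersetCard m → a ∉ t :=
    fun ht h => ha ((mem_powersetCard.1 ht).1 h)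
  rw [elemSym, powersetCard_succ_insert ha, sum_union, sum_image, elemSym, elemSym, mul_sum]
  · congr 1
    exact sum_congr rfl fun t ht => prod_insert (hmem ht)
  · intro t ht t' ht' h
    rw [← erase_insert (hmem ht), h, erase_insert (hmem ht')]
  · refine disjoint_left.2 fun t ht h => ?_
    obtain ⟨u, -, rfl⟩ := mem_image.1 h
    exact hmem ht (mem_insert_self a u)

lemma elemSym_map (e : ℕ ↪ ℕ) (s : Finset ℕ) (w : ℕ → R) (r : ℕ) :
    elemSym (s.map e) w r = elemSym s (fun x => w (e x)) r := by
  simp [elemSym, powersetCard_map]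

lemma elemSym_congr {s : Finset ℕ} {w w' : ℕ → R} (h : ∀ x ∈ s, w x = w' x) (r : ℕ) :
    elemSym s w r = elemSym s w' r :=
  sum_congr rfl fun _ ht => prod_congr rfl fun _ hx => h _ ((mem_powersetCard.1 ht).1 hx)

lemma elemSym_mul_const (s : Finset ℕ) (w : ℕ → R) (c : R) (r : ℕ) :
    elemSym s (fun x => w x * c) r = elemSym s w r * c ^ r := by
  rw [elemSym, elemSym, sum_mul]
  refine sum_congr rfl fun t ht => ?_
  rw [prod_mul_distrib, prod_const, (mem_powersetCard.1 ht).2]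

lemma elemSym_eq_sum_sublistsLen (s : Finset ℕ) (w : ℕ → R) (r : ℕ) :
    elemSym s w r = (((s.sort (· ≤ ·)).sublistsLen r).map fun c => (c.map w).prod).sum := by
  rw [elemSym, ← Finset.esymm_map_val, Multiset.esymm, Multiset.powersetCard_map,
    ← Finset.sort_eq s (· ≤ ·), Multiset.powersetCard_coe]
  simp [Function.comp_def]

lemma sum_mul_elemSym_erase (s : Finset ℕ) (w : ℕ → R) (q p : R) (r : ℕ) :
    ∑ b ∈ s, w b * elemSym (s.erase b) (fun x => w x * if x < b then q else p) r =
      (∑ t ∈ range (r + 1), q ^ t * p ^ (r - t)) * elemSym s w (r + 1) := by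
  induction s using Finset.induction_on_max generalizing r with
  | empty => simp [elemSym, powersetCard_eq_empty.2 (show #(∅ : Finset ℕ) < r + 1 by simp)]
  | insert a s hmax ih =>
    have ha : a ∉ s := fun h => lt_irrefl a (hmax a h)
    have hlast : elemSym s (fun x => w x * if x < a then q else p) r = elemSym s w r * q ^ r := by
      rw [← elemSym_mul_const]
      exact elemSym_congr (fun x hx => by simp [hmax x hx]) r
    have herase : ∀ b ∈ s, (insert a s).erase b = insert a (s.erase b) := fun b hb =>
      erase_insert_of_ne (hmax b hb).ne'
    rw [sum_insert ha, erase_insert ha, hlast, sum_congr rfl fun b hb => by rw [herase b hb]]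
    cases r with
    | zero =>
      simp only [elemSym_zero, elemSym_insert ha]
      simp [elemSym, powersetCard_one, add_comm]
    | succ r =>
      have hstep : ∀ b ∈ s, w b * elemSym (insert a (s.erase b))
            (fun x => w x * if x < b then q else p) (r + 1) =
          w b * elemSym (s.erase b) (fun x => w x * if x < b then q else p) (r + 1) +
          w a * p * (w b * elemSym (s.erase b) (fun x => w x * if x < b then q else p) r) := by
        intro b hb
        rw [elemSym_insert (fun h => ha (mem_of_mem_erase h)), if_neg (hmax b hb).not_gt]
        ring
      rw [sum_congr rfl hstep, sum_add_distrib, ← mul_sum, ih, ih, elemSym_insert ha]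
      have hbr : ∑ t ∈ range (r + 1 + 1), q ^ t * p ^ (r + 1 - t) =
          p * (∑ t ∈ range (r + 1), q ^ t * p ^ (r - t)) + q ^ (r + 1) := by
        rw [sum_range_succ, mul_sum]
        congr 1
        · refine sum_congr rfl fun t ht => ?_
          rw [Nat.sub_add_comm (Nat.lt_succ_iff.1 (mem_range.1 ht)), pow_succ]
          ring
        · simp
      rw [hbr]
      ring

end ElementarySymmetric

open MvPolynomial in
/-- The weight of the position `x` relative to `p`. -/
noncomputable def posWeight {n : ℕ} (p : SetPartition n) (x : ℕ) : MvPolynomial (Fin 2) ℤ :=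
  X 0 ^ coverCount p x * X 1 ^ beforeCount p x

open MvPolynomial in
/-- The contribution of the partition `μ` to `bPoly`. -/
noncomputable def contribution {n : ℕ} (μ : SetPartition n) (r : ℕ) : MvPolynomial (Fin 2) ℤ :=
  ((fStat ((0 : ℤ), (0 : ℤ)) r (seqCN μ)).map fun v => X 0 ^ v.1.toNat * X 1 ^ v.2.toNat).sum

lemma seqCN_eq {n : ℕ} (μ : SetPartition n) :
    seqCN μ = (minsSorted μ).map fun x =>
      (((cr μ + coverCount μ x : ℕ) : ℤ), ((ne' μ + beforeCount μ x : ℕ) : ℤ)) := by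
  have hlen : (minsSorted μ).length = μ.parts.card := by
    rw [← card_blockMins]; exact length_sort _
  apply List.ext_getElem
  · simp [seqCN, hlen]
  · intro i h₁ h₂
    have hi : i < (minsSorted μ).length := by simpa using h₂
    have hmem : (minsSorted μ)[i] ∈ blockMins μ := (mem_sort (· ≤ ·)).1 (List.getElem_mem hi)
    obtain ⟨b, hb, hbi⟩ := (mem_blockMins μ _).1 hmem
    simp only [seqCN, List.getElem_map, List.getElem_range, childAt_succ,
      List.getD_eq_getElem _ _ hi, ← hbi, cr_extendBy_some hb, ne'_extendBy_some hb]

lemma coverCount_zero {n : ℕ} (μ : SetPartition n) : coverCount μ 0 = 0 := by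
  simp [coverCount]

lemma beforeCount_zero {n : ℕ} (μ : SetPartition n) : beforeCount μ 0 = 0 := by
  simp [beforeCount]

lemma posWeight_zero {n : ℕ} (μ : SetPartition n) : posWeight μ 0 = 1 := by
  simp [posWeight, coverCount_zero, beforeCount_zero]

lemma zero_mem_blockMins {n : ℕ} (μ : SetPartition n) (hn : 0 < n) : 0 ∈ blockMins μ :=
  (mem_blockMins μ 0).2 ⟨⟨0, hn⟩, fun _ _ => Nat.zero_le _, rfl⟩

lemma minsSorted_eq_cons {n : ℕ} (μ : SetPartition n) (hn : 0 < n) :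
    minsSorted μ = 0 :: ((blockMins μ).erase 0).sort (· ≤ ·) := by
  rw [← sort_insert _ (fun _ _ => Nat.zero_le _) (notMem_erase 0 _),
    insert_erase (zero_mem_blockMins μ hn)]
  rfl

lemma sum_map_seq {n : ℕ} (μ : SetPartition n) (c : List ℕ) :
    (c.map fun x => (((cr μ + coverCount μ x : ℕ) : ℤ),
      ((ne' μ + beforeCount μ x : ℕ) : ℤ))).sum =
      ((c.length * cr μ + (c.map (coverCount μ)).sum : ℤ),
        (c.length * ne' μ + (c.map (beforeCount μ)).sum : ℤ)) := by
  induction c with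
  | nil => ext <;> simp
  | cons a c ih =>
    rw [List.map_cons, List.sum_cons, ih]
    ext <;> simp <;> ring

lemma prod_map_posWeight {n : ℕ} (μ : SetPartition n) (c : List ℕ) :
    (c.map (posWeight μ)).prod = MvPolynomial.X 0 ^ (c.map (coverCount μ)).sum *
      MvPolynomial.X 1 ^ (c.map (beforeCount μ)).sum := by
  induction c with
  | nil => simp
  | cons a c ih =>
    simp only [List.map_cons, List.prod_cons, List.sum_cons, ih, posWeight, pow_add]
    ring

lemma sublistsLen_map {α β : Type*} (f : α → β) (r : ℕ) (l : List α) :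
    (l.map f).sublistsLen r = (l.sublistsLen r).map (List.map f) := by
  induction l generalizing r with
  | nil => cases r <;> simp
  | cons a l ih => cases r <;> simp [ih, Function.comp_def]

lemma contribution_eq {n : ℕ} (μ : SetPartition n) (hn : 0 < n) (r : ℕ) :
    contribution μ r = MvPolynomial.X 0 ^ cr μ * MvPolynomial.X 1 ^ ne' μ *
      elemSym ((blockMins μ).erase 0) (posWeight μ) r := by
  rw [contribution, fStat, seqCN_eq, minsSorted_eq_cons μ hn, elemSym_eq_sum_sublistsLen,
    ← List.sum_map_mul_left, List.map_cons, List.tail_cons, List.headD_cons, sublistsLen_map,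
    List.map_map, Multiset.map_coe, List.map_map, Multiset.sum_coe]
  congr 1
  refine List.map_congr_left fun c hc => ?_
  have hlen : c.length = r := (List.mem_sublistsLen.1 hc).2
  simp only [Function.comp_apply, sum_map_seq, prod_map_posWeight, coverCount_zero,
    beforeCount_zero, hlen]
  have h : ∀ a s : ℕ, ((r * a + s : ℤ) - ((r : ℤ) - 1) * ((a + 0 : ℕ) : ℤ) + 0).toNat = a + s := by
    intro a s
    have : ((r * a + s : ℤ) - ((r : ℤ) - 1) * ((a + 0 : ℕ) : ℤ) + 0) = ((a + s : ℕ) : ℤ) := by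
      push_cast; ring
    rw [this, Int.toNat_natCast]
  simp only [Prod.fst_add, Prod.fst_sub, Prod.smul_fst, Prod.snd_add, Prod.snd_sub, Prod.smul_snd,
    smul_eq_mul, h, pow_add]
  ring

lemma contribution_extendBy_none {n : ℕ} (μ : SetPartition n) (r : ℕ) :
    contribution (extendBy μ none) r = MvPolynomial.X 0 ^ cr μ * MvPolynomial.X 1 ^ ne' μ *
      elemSym (blockMins μ) (posWeight μ) r := by
  rw [contribution_eq _ n.succ_pos, cr_extendBy_none, ne'_extendBy_none, blockMins_extendBy_none,
    elemSym_map, elemSym_congr (w' := posWeight μ)]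
  intro x _
  simp only [addRightEmbedding_apply, posWeight, coverCount_extendBy_none,
    beforeCount_extendBy_none]

lemma contribution_extendBy_some {n : ℕ} (μ : SetPartition n) {b : ℕ} (hb : b ∈ blockMins μ)
    (r : ℕ) :
    contribution (extendBy μ (some b)) r = MvPolynomial.X 0 ^ cr μ * MvPolynomial.X 1 ^ ne' μ *
      (posWeight μ b * elemSym ((blockMins μ).erase b)
        (fun x => posWeight μ x * if x < b then MvPolynomial.X 0 else MvPolynomial.X 1) r) := by
  obtain ⟨b, hmin, rfl⟩ := (mem_blockMins μ b).1 hb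
  rw [contribution_eq _ n.succ_pos, cr_extendBy_some hmin, ne'_extendBy_some hmin,
    blockMins_extendBy_some hmin,
    elemSym_map, elemSym_congr (w' := fun x => posWeight μ x *
      if x < b then MvPolynomial.X 0 else MvPolynomial.X 1)]
  · rw [posWeight]; ring
  · intro x hx
    simp only [addRightEmbedding_apply, posWeight, coverCount_extendBy_some hmin,
      beforeCount_extendBy_some hmin]
    rcases lt_or_gt_of_ne (ne_of_mem_erase hx) with h | h
    · simp only [h, h.not_gt, if_true, if_false]; ring
    · simp only [h, h.not_gt, if_true, if_false]; ring

lemma sum_contribution_children {n : ℕ} (μ : SetPartition n) (hn : 0 < n) (r : ℕ) :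
    contribution (extendBy μ none) r + ∑ b ∈ blockMins μ, contribution (extendBy μ (some b)) r =
      (if r = 0 then 0 else contribution μ (r - 1)) + (1 + bracket (r + 1)) * contribution μ r
        + bracket (r + 1) * contribution μ (r + 1) := by
  have hins : blockMins μ = insert 0 ((blockMins μ).erase 0) :=
    (insert_erase (zero_mem_blockMins μ hn)).symm
  have hsym : ∀ r, elemSym (blockMins μ) (posWeight μ) (r + 1) =
      elemSym ((blockMins μ).erase 0) (posWeight μ) (r + 1) +
        elemSym ((blockMins μ).erase 0) (posWeight μ) r := by
    intro r
    conv_lhs => rw [hins]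
    rw [elemSym_insert (notMem_erase 0 _), posWeight_zero, one_mul]
  rw [sum_congr rfl fun b hb => contribution_extendBy_some μ hb r, ← mul_sum,
    sum_mul_elemSym_erase, contribution_extendBy_none, hsym]
  simp only [contribution_eq μ hn, bracket, Nat.add_sub_cancel]
  cases r with
  | zero => simp only [elemSym_zero, if_true]; ring
  | succ r =>
    rw [hsym, if_neg r.succ_ne_zero, Nat.add_sub_cancel]
    ring

lemma bPoly_eq {n : ℕ} (p : SetPartition n) (l r : ℕ) :
    bPoly p l r = ∑ᶠ μ ∈ level p l, contribution μ r := rfl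

/-- Proposition 5.1. For a nonempty partition `π` with `k ≥ 1` blocks
and all `l ≥ 1`, `r ≥ 0`:
`b_{l,r} = b_{l-1,r-1} + (1 + [r+1]_{q,p})·b_{l-1,r} + [r+1]_{q,p}·b_{l-1,r+1}`,
with the convention `b_{l-1,-1} = 0`. -/
theorem statement19 {n k : ℕ} (p : SetPartition n) (hpk : p.parts.card = k)
    (hk : 1 ≤ k) :
    ∀ l r : ℕ, 1 ≤ l →
      bPoly p l r = (if r = 0 then 0 else bPoly p (l - 1) (r - 1))
        + (1 + bracket (r + 1)) * bPoly p (l - 1) r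
        + bracket (r + 1) * bPoly p (l - 1) (r + 1) := by
  intro l r hl
  obtain ⟨B, hB⟩ := card_pos.1 (hpk ▸ hk)
  obtain ⟨x, -⟩ := p.nonempty_of_mem_parts hB
  obtain ⟨l, rfl⟩ := Nat.exists_eq_add_of_le' hl
  have hfin : (level p l).Finite := Set.toFinite _
  rw [Nat.add_sub_cancel]
  simp only [bPoly_eq]
  rw [finsum_mem_level_succ,
    finsum_mem_congr rfl fun μ _ => sum_contribution_children μ (by have := x.pos; omega) r,
    finsum_mem_add_distrib hfin, finsum_mem_add_distrib hfin, ← mul_finsum_mem' _ _ hfin,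
    ← mul_finsum_mem' _ _ hfin]
  split_ifs <;> simp
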